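/- arXiv:2304.04474 — 5 statements merged into one kernel-verified Lean document; each statement's English description precedes it below -/
import Mathlib

section
/- Let A ∈ ℝ^{n×n} be symmetric with nonnegative entries and zero diagonal, let D_ii = Σ_j A_{ij}, and let Δ̃ = I_n − (D+I_n)^{-1/2}(A+I_n)(D+I_n)^{-1/2} be the augmented normalized Laplacian. Then every eigenvalue λ of Δ̃ satisfies 0 ≤ λ < 2; in particular Δ̃ is positive semidefinite and its largest eigenvalue is strictly smaller than 2. -/
open Matrix BigOperators

/-- Degree of node `i` in the weighted graph with adjacency matrix `A`. -/
noncomputable def deg {n : ℕ} (A : Matrix (Fin n) (Fin n) ℝ) (i : Fin n) : ℝ := ∑ j, A i j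

/-- The diagonal matrix `(D + I)^{-1/2}` with entries `1/√(1 + D_ii)`. -/
noncomputable def dHalfInv {n : ℕ} (A : Matrix (Fin n) (Fin n) ℝ) : Matrix (Fin n) (Fin n) ℝ :=
  Matrix.diagonal fun i => (Real.sqrt (1 + deg A i))⁻¹

/-- The augmented normalized Laplacian `Δ̃ = I - (D+I)^{-1/2} (A+I) (D+I)^{-1/2}`. -/
noncomputable def augLap {n : ℕ} (A : Matrix (Fin n) (Fin n) ℝ) : Matrix (Fin n) (Fin n) ℝ :=
  1 - dHalfInv A * (A + 1) * dHalfInv A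

theorem isHermitian_dHalfInv {n : ℕ} (A : Matrix (Fin n) (Fin n) ℝ) : (dHalfInv A).IsHermitian :=
  isHermitian_diagonal _

theorem deg_nonneg {n : ℕ} {A : Matrix (Fin n) (Fin n) ℝ} (hnn : ∀ i j, 0 ≤ A i j) (i : Fin n) :
    0 ≤ deg A i :=
  Finset.sum_nonneg fun j _ => hnn i j

theorem dHalfInv_mul_diagonal_mul_dHalfInv {n : ℕ} {A : Matrix (Fin n) (Fin n) ℝ}
    (hnn : ∀ i j, 0 ≤ A i j) :
    dHalfInv A * (1 + diagonal (deg A)) * dHalfInv A = 1 := by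
  rw [dHalfInv, ← diagonal_one, diagonal_add, diagonal_mul_diagonal, diagonal_mul_diagonal]
  congr 1
  funext i
  have h : 0 < 1 + deg A i := by linarith [deg_nonneg hnn i]
  have hs := (Real.sqrt_pos.2 h).ne'
  field_simp
  exact (Real.sq_sqrt h.le).symm

theorem augLap_eq {n : ℕ} {A : Matrix (Fin n) (Fin n) ℝ} (hnn : ∀ i j, 0 ≤ A i j) :
    augLap A = dHalfInv A * (diagonal (deg A) - A) * dHalfInv A := by
  rw [augLap]
  nth_rewrite 1 [← dHalfInv_mul_diagonal_mul_dHalfInv hnn]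
  noncomm_ring

theorem two_sub_augLap_eq {n : ℕ} {A : Matrix (Fin n) (Fin n) ℝ} (hnn : ∀ i j, 0 ≤ A i j) :
    2 - augLap A = dHalfInv A * (diagonal (deg A) + A) * dHalfInv A
      + (2 : ℝ) • (dHalfInv A * dHalfInv A) := by
  have h : (2 : Matrix (Fin n) (Fin n) ℝ) = 1 + 1 := one_add_one_eq_two.symm
  rw [augLap, h, add_sub_assoc, sub_sub_cancel, two_smul]
  nth_rewrite 1 [← dHalfInv_mul_diagonal_mul_dHalfInv hnn]
  noncomm_ring

/-- The quadratic form of `D + s A` with `s = ±1` is `½ ∑ A i j (x i + s x j)²`. -/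
theorem two_mul_dotProduct_diagonal_deg_add_smul {n : ℕ} {A : Matrix (Fin n) (Fin n) ℝ}
    (hsym : Aᵀ = A) {s : ℝ} (hs : s ^ 2 = 1) (x : Fin n → ℝ) :
    2 * (x ⬝ᵥ ((diagonal (deg A) + s • A) *ᵥ x)) = ∑ i, ∑ j, A i j * (x i + s * x j) ^ 2 := by
  have hx : x ⬝ᵥ ((diagonal (deg A) + s • A) *ᵥ x)
      = ∑ i, ∑ j, A i j * x i ^ 2 + ∑ i, ∑ j, s * A i j * x i * x j := by
    rw [add_mulVec, dotProduct_add]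
    congr 1
    · simp only [dotProduct, mulVec_diagonal, deg, Finset.sum_mul, Finset.mul_sum]
      exact Finset.sum_congr rfl fun i _ => Finset.sum_congr rfl fun j _ => by ring
    · simp only [dotProduct, mulVec, Matrix.smul_apply, smul_eq_mul, Finset.mul_sum]
      exact Finset.sum_congr rfl fun i _ => Finset.sum_congr rfl fun j _ => by ring
  have hswap : ∑ i, ∑ j, A i j * x i ^ 2 = ∑ i, ∑ j, A i j * x j ^ 2 := by
    rw [Finset.sum_comm]
    refine Finset.sum_congr rfl fun i _ => Finset.sum_congr rfl fun j _ => ?_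
    rw [← transpose_apply A, hsym]
  rw [hx, mul_add, two_mul]
  nth_rewrite 2 [hswap]
  simp only [Finset.mul_sum, ← Finset.sum_add_distrib]
  refine Finset.sum_congr rfl fun i _ => Finset.sum_congr rfl fun j _ => ?_
  linear_combination -(A i j * x j ^ 2) * hs

theorem posSemidef_diagonal_deg_add_smul {n : ℕ} {A : Matrix (Fin n) (Fin n) ℝ}
    (hsym : Aᵀ = A) (hnn : ∀ i j, 0 ≤ A i j) {s : ℝ} (hs : s ^ 2 = 1) :
    (diagonal (deg A) + s • A).PosSemidef := by
  refine PosSemidef.of_dotProduct_mulVec_nonneg ?_ fun x => ?_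
  · simp [IsHermitian, conjTranspose_eq_transpose_of_trivial, hsym]
  · have h : 0 ≤ ∑ i, ∑ j, A i j * (x i + s * x j) ^ 2 :=
      Finset.sum_nonneg fun i _ => Finset.sum_nonneg fun j _ => mul_nonneg (hnn i j) (sq_nonneg _)
    rw [← two_mul_dotProduct_diagonal_deg_add_smul hsym hs] at h
    rw [star_trivial]
    linarith

theorem posSemidef_augLap {n : ℕ} {A : Matrix (Fin n) (Fin n) ℝ}
    (hsym : Aᵀ = A) (hnn : ∀ i j, 0 ≤ A i j) : (augLap A).PosSemidef := by
  have h := (posSemidef_diagonal_deg_add_smul hsym hnn (s := -1)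
    (by norm_num)).conjTranspose_mul_mul_same (dHalfInv A)
  rwa [(isHermitian_dHalfInv A).eq, neg_one_smul, ← sub_eq_add_neg, ← augLap_eq hnn] at h

theorem posDef_two_sub_augLap {n : ℕ} {A : Matrix (Fin n) (Fin n) ℝ}
    (hsym : Aᵀ = A) (hnn : ∀ i j, 0 ≤ A i j) : (2 - augLap A).PosDef := by
  have h := (posSemidef_diagonal_deg_add_smul hsym hnn (s := 1)
    (by norm_num)).conjTranspose_mul_mul_same (dHalfInv A)
  rw [(isHermitian_dHalfInv A).eq, one_smul] at h
  rw [two_sub_augLap_eq hnn]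
  refine PosDef.posSemidef_add h (PosDef.smul ?_ two_pos)
  rw [dHalfInv, diagonal_mul_diagonal]
  refine PosDef.diagonal fun i => ?_
  have : 0 < 1 + deg A i := by linarith [deg_nonneg hnn i]
  positivity

/-- The augmented normalized Laplacian is positive semidefinite and every one of its
eigenvalues `λ` satisfies `0 ≤ λ < 2`; in particular its largest eigenvalue is
strictly smaller than `2`. -/
theorem augLap_posSemidef_and_eigenvalues_lt_two {n : ℕ} (A : Matrix (Fin n) (Fin n) ℝ)
    (hsym : Aᵀ = A) (hnn : ∀ i j, 0 ≤ A i j) (hdiag : ∀ i, A i i = 0) :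
    (augLap A).PosSemidef ∧
      ∀ lam : ℝ, (∃ v : Fin n → ℝ, v ≠ 0 ∧ augLap A *ᵥ v = lam • v) →
        0 ≤ lam ∧ lam < 2 := by
  have hpsd := posSemidef_augLap hsym hnn
  refine ⟨hpsd, ?_⟩
  rintro lam ⟨v, hv, hlam⟩
  have hvv : 0 < v ⬝ᵥ v := by simpa using dotProduct_star_self_pos_iff.2 hv
  constructor
  · have h := hpsd.dotProduct_mulVec_nonneg v
    rw [hlam, star_trivial, dotProduct_smul, smul_eq_mul] at h
    exact nonneg_of_mul_nonneg_left h hvv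
  · have h := (posDef_two_sub_augLap hsym hnn).dotProduct_mulVec_pos hv
    have h2 : (2 : Matrix (Fin n) (Fin n) ℝ) *ᵥ v = (2 : ℝ) • v := ofNat_mulVec 2 v
    rw [sub_mulVec, hlam, h2, ← sub_smul, star_trivial, dotProduct_smul, smul_eq_mul] at h
    exact sub_pos.1 (pos_of_mul_pos_left h hvv.le)
end

section
/- Let y = (D+I_n)^{-1/2} x for x ∈ ℝ^n, and write Ã = A + I_n. Then xᵀ ( I_n + (D+I_n)^{-1/2} Ã (D+I_n)^{-1/2} ) x = (1/2) Σ_{i,j=1}^{n} Ã_{ij} ( y_i + y_j )². Consequently the matrix 2·I_n − Δ̃ = I_n + (D+I_n)^{-1/2} Ã (D+I_n)^{-1/2} is positive definite, since the right-hand side is strictly positive for x ≠ 0 (the diagonal self-loop terms contribute Σ_i Ã_{ii} · 2 y_i² > 0). -/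
open Matrix BigOperators

theorem half_sum_mul_add_sq {ι : Type*} [Fintype ι] {B : Matrix ι ι ℝ} (hB : B.IsSymm)
    (y : ι → ℝ) :
    (1 / 2) * ∑ i, ∑ j, B i j * (y i + y j) ^ 2 =
      ∑ i, (∑ j, B i j) * y i ^ 2 + ∑ i, ∑ j, y i * B i j * y j := by
  have hswap : ∑ i, ∑ j, B i j * y j ^ 2 = ∑ i, ∑ j, B i j * y i ^ 2 := by
    rw [Finset.sum_comm]
    simp only [hB.apply]
  have hexpand : ∑ i, ∑ j, B i j * (y i + y j) ^ 2 =
      ∑ i, ∑ j, B i j * y i ^ 2 + ∑ i, ∑ j, B i j * y j ^ 2 +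
        2 * ∑ i, ∑ j, y i * B i j * y j := by
    simp only [Finset.mul_sum, ← Finset.sum_add_distrib]
    refine Finset.sum_congr rfl fun i _ => Finset.sum_congr rfl fun j _ => ?_
    ring
  simp only [Finset.sum_mul]
  rw [hexpand, hswap]
  ring

theorem dotProduct_one_add_diagonal_conj_mulVec {ι : Type*} [Fintype ι] [DecidableEq ι]
    (B : Matrix ι ι ℝ) (d x : ι → ℝ) :
    x ⬝ᵥ ((1 + diagonal d * B * diagonal d) *ᵥ x) =
      ∑ i, x i ^ 2 + ∑ i, ∑ j, (x i * d i) * B i j * (x j * d j) := by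
  rw [add_mulVec, one_mulVec, dotProduct_add]
  simp only [dotProduct, mulVec, mul_diagonal, diagonal_mul, Finset.mul_sum]
  congr 1
  · exact Finset.sum_congr rfl fun i _ => (sq (x i)).symm
  · refine Finset.sum_congr rfl fun i _ => Finset.sum_congr rfl fun j _ => ?_
    ring

theorem sum_add_one_apply {n : ℕ} (A : Matrix (Fin n) (Fin n) ℝ) (i : Fin n) :
    ∑ j, (A + 1) i j = 1 + deg A i := by
  simp [deg, Matrix.one_apply, Finset.sum_add_distrib, add_comm]

theorem one_add_deg_pos {n : ℕ} {A : Matrix (Fin n) (Fin n) ℝ} (hnn : ∀ i j, 0 ≤ A i j)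
    (i : Fin n) : 0 < 1 + deg A i :=
  add_pos_of_pos_of_nonneg one_pos (Finset.sum_nonneg fun j _ => hnn i j)

theorem dotProduct_one_add_normalized_mulVec {n : ℕ} {A : Matrix (Fin n) (Fin n) ℝ}
    (hsym : Aᵀ = A) (hnn : ∀ i j, 0 ≤ A i j) (x : Fin n → ℝ) :
    x ⬝ᵥ ((1 + dHalfInv A * (A + 1) * dHalfInv A) *ᵥ x) =
      (1 / 2) * ∑ i, ∑ j, (A + 1) i j *
        (x i / Real.sqrt (1 + deg A i) + x j / Real.sqrt (1 + deg A j)) ^ 2 := by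
  have hB : (A + 1).IsSymm := IsSymm.add hsym isSymm_one
  rw [half_sum_mul_add_sq hB fun i => x i / Real.sqrt (1 + deg A i), dHalfInv,
    dotProduct_one_add_diagonal_conj_mulVec]
  simp only [← div_eq_mul_inv, sum_add_one_apply]
  congr 1
  refine Finset.sum_congr rfl fun i _ => ?_
  have hi := one_add_deg_pos hnn i
  rw [div_pow, Real.sq_sqrt hi.le, mul_div_cancel₀ _ hi.ne']

theorem sum_mul_add_sq_pos {ι : Type*} [Fintype ι] {B : Matrix ι ι ℝ}
    (hB : ∀ i j, 0 ≤ B i j) (hdiag : ∀ i, 0 < B i i) {y : ι → ℝ} (hy : y ≠ 0) :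
    0 < ∑ i, ∑ j, B i j * (y i + y j) ^ 2 := by
  obtain ⟨k, hk⟩ := Function.ne_iff.mp hy
  have hterm (i j : ι) : 0 ≤ B i j * (y i + y j) ^ 2 := mul_nonneg (hB i j) (sq_nonneg _)
  refine Finset.sum_pos' (fun i _ => Finset.sum_nonneg fun j _ => hterm i j)
    ⟨k, Finset.mem_univ k, Finset.sum_pos' (fun j _ => hterm k j) ⟨k, Finset.mem_univ k, ?_⟩⟩
  have hkk : y k + y k ≠ 0 := by simpa [← two_mul] using hk
  have := hdiag k
  positivity

/-- With `y = (D+I)^{-1/2} x` and `Ã = A + I`, we have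
`xᵀ (I + (D+I)^{-1/2} Ã (D+I)^{-1/2}) x = (1/2) Σ_{i,j} Ã_{ij} (y_i + y_j)²`;
consequently `2·I - Δ̃ = I + (D+I)^{-1/2} Ã (D+I)^{-1/2}` is positive definite. -/
theorem two_sub_augLap_posDef {n : ℕ} (A : Matrix (Fin n) (Fin n) ℝ)
    (hsym : Aᵀ = A) (hnn : ∀ i j, 0 ≤ A i j) (hdiag : ∀ i, A i i = 0) :
    (∀ x : Fin n → ℝ,
      x ⬝ᵥ ((1 + dHalfInv A * (A + 1) * dHalfInv A) *ᵥ x) =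
        (1 / 2) * ∑ i, ∑ j, (A + 1) i j *
          (x i / Real.sqrt (1 + deg A i) + x j / Real.sqrt (1 + deg A j)) ^ 2) ∧
    ((2 : ℝ) • (1 : Matrix (Fin n) (Fin n) ℝ) - augLap A).PosDef := by
  refine ⟨dotProduct_one_add_normalized_mulVec hsym hnn, ?_⟩
  have heq : (2 : ℝ) • (1 : Matrix (Fin n) (Fin n) ℝ) - augLap A =
      1 + dHalfInv A * (A + 1) * dHalfInv A := by
    rw [augLap, two_smul]
    abel
  rw [heq]
  refine PosDef.of_dotProduct_mulVec_pos ?_ fun x hx => ?_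
  · rw [IsHermitian, conjTranspose_eq_transpose_of_trivial]
    simp [dHalfInv, transpose_mul, hsym, Matrix.mul_assoc]
  · rw [star_trivial, dotProduct_one_add_normalized_mulVec hsym hnn]
    refine mul_pos one_half_pos (sum_mul_add_sq_pos (B := A + 1)
      (y := fun i => x i / Real.sqrt (1 + deg A i)) (fun i j => ?_) (fun i => ?_) ?_)
    · rw [Matrix.add_apply, Matrix.one_apply]
      have := hnn i j
      positivity
    · simp [hdiag i]
    · obtain ⟨k, hk⟩ := Function.ne_iff.mp hx
      exact Function.ne_iff.mpr
        ⟨k, div_ne_zero hk (Real.sqrt_pos.mpr (one_add_deg_pos hnn k)).ne'⟩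
end

section
/- Let Δ ∈ ℝ^{n×n} be a symmetric positive semidefinite matrix that has at least one nonzero eigenvalue, let P = I_n − Δ, and set c = min { (1 − λ)² : λ a nonzero eigenvalue of Δ }. Then for every X ∈ ℝ^{n×d}, tr( (P X)ᵀ Δ (P X) ) ≥ c · tr( Xᵀ Δ X ); i.e., one (linear, simplified) graph-convolution layer shrinks the Dirichlet energy by at most the factor (1 − λ₁)², where λ₁ is the nonzero eigenvalue of Δ closest to 1. -/
open Matrix BigOperators

theorem Matrix.trace_transpose_mul_diagonal_mul {m k : Type*} [Fintype m] [DecidableEq m]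
    [Fintype k] (v : m → ℝ) (Y : Matrix m k ℝ) :
    (Yᵀ * diagonal v * Y).trace = ∑ j, ∑ i, v i * Y i j ^ 2 := by
  refine Finset.sum_congr rfl fun j _ => ?_
  rw [diag_apply, mul_apply]
  refine Finset.sum_congr rfl fun i _ => ?_
  rw [mul_diagonal, transpose_apply]
  ring

theorem Matrix.IsHermitian.exists_orthogonal_diagonalization {m : Type*} [Fintype m]
    [DecidableEq m] {A : Matrix m m ℝ} (hA : A.IsHermitian) :
    ∃ U : Matrix m m ℝ, Uᵀ * U = 1 ∧ A = U * diagonal hA.eigenvalues * Uᵀ := by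
  refine ⟨hA.eigenvectorUnitary, ?_, ?_⟩
  · simpa [star_eq_conjTranspose] using Unitary.coe_star_mul_self hA.eigenvectorUnitary
  · simpa [Unitary.conjStarAlgAut_apply, star_eq_conjTranspose, Function.comp_def]
      using hA.spectral_theorem

/-- For a symmetric PSD matrix `Δ` having a nonzero eigenvalue, one linear simplified
GCN layer `X ↦ (I - Δ) X` shrinks the Dirichlet energy `tr(Xᵀ Δ X)` by at most the
factor `c = min {(1-λ)² : λ nonzero eigenvalue of Δ}`. -/
theorem simple_gcn_energy_lower_bound {n d : ℕ} (Δ : Matrix (Fin n) (Fin n) ℝ)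
    (hΔ : Δ.IsHermitian) (hpsd : Δ.PosSemidef)
    (hnz : ∃ i, hΔ.eigenvalues i ≠ 0)
    (c : ℝ)
    (hlb : ∀ i, hΔ.eigenvalues i ≠ 0 → c ≤ (1 - hΔ.eigenvalues i) ^ 2)
    (hattained : ∃ i, hΔ.eigenvalues i ≠ 0 ∧ c = (1 - hΔ.eigenvalues i) ^ 2)
    (X : Matrix (Fin n) (Fin d) ℝ) :
    c * Matrix.trace (Xᵀ * Δ * X) ≤
      Matrix.trace ((((1 : Matrix (Fin n) (Fin n) ℝ) - Δ) * X)ᵀ * Δ *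
        (((1 : Matrix (Fin n) (Fin n) ℝ) - Δ) * X)) := by
  obtain ⟨U, hU, hdiag⟩ := hΔ.exists_orthogonal_diagonalization
  have energy (Z : Matrix (Fin n) (Fin d) ℝ) :
      (Zᵀ * Δ * Z).trace = ∑ j, ∑ i, hΔ.eigenvalues i * (Uᵀ * Z) i j ^ 2 := by
    rw [← trace_transpose_mul_diagonal_mul, transpose_mul, transpose_transpose]
    conv_lhs => rw [hdiag]
    simp only [Matrix.mul_assoc]
  have layer (i : Fin n) (j : Fin d) :
      (Uᵀ * (((1 : Matrix (Fin n) (Fin n) ℝ) - Δ) * X)) i j =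
        (1 - hΔ.eigenvalues i) * (Uᵀ * X) i j := by
    have hUΔ : Uᵀ * Δ = diagonal hΔ.eigenvalues * Uᵀ := by
      conv_lhs => rw [hdiag]
      rw [← Matrix.mul_assoc, ← Matrix.mul_assoc, hU, Matrix.one_mul]
    rw [← Matrix.mul_assoc, Matrix.mul_sub, Matrix.mul_one, hUΔ, Matrix.sub_mul,
      Matrix.mul_assoc, Matrix.sub_apply, diagonal_mul]
    ring
  rw [energy, energy, Finset.mul_sum]
  refine Finset.sum_le_sum fun j _ => ?_
  rw [Finset.mul_sum]
  refine Finset.sum_le_sum fun i _ => ?_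
  rw [layer]
  obtain h | h := eq_or_ne (hΔ.eigenvalues i) 0
  · simp [h]
  · calc c * (hΔ.eigenvalues i * (Uᵀ * X) i j ^ 2)
        ≤ (1 - hΔ.eigenvalues i) ^ 2 * (hΔ.eigenvalues i * (Uᵀ * X) i j ^ 2) :=
          mul_le_mul_of_nonneg_right (hlb i h)
            (mul_nonneg (hpsd.eigenvalues_nonneg i) (sq_nonneg _))
      _ = hΔ.eigenvalues i * ((1 - hΔ.eigenvalues i) * (Uᵀ * X) i j) ^ 2 := by ring
end

section
/- Let Δ ∈ ℝ^{n×n} be a symmetric positive semidefinite matrix and let P_l = I_n + Δ (the Laplacian-sharpening filter, i.e., the first-order Maclaurin approximation of the graph deconvolution filter). Then for every X ∈ ℝ^{n×d}, tr( (P_l X)ᵀ Δ (P_l X) ) ≥ tr( Xᵀ Δ X ); i.e., the sharpening layer does not decrease the graph Dirichlet energy. -/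
open Matrix BigOperators

/-- For a symmetric PSD matrix `Δ`, the Laplacian-sharpening layer `X ↦ (I + Δ) X`
does not decrease the graph Dirichlet energy `tr(Xᵀ Δ X)`. -/
theorem sharpening_energy_nondecreasing {n d : ℕ} (Δ : Matrix (Fin n) (Fin n) ℝ)
    (hΔ : Δ.IsHermitian) (hpsd : Δ.PosSemidef)
    (X : Matrix (Fin n) (Fin d) ℝ) :
    Matrix.trace (Xᵀ * Δ * X) ≤
      Matrix.trace ((((1 : Matrix (Fin n) (Fin n) ℝ) + Δ) * X)ᵀ * Δ *
        (((1 : Matrix (Fin n) (Fin n) ℝ) + Δ) * X)) := by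
  have hT : Δᵀ = Δ := by simpa using hΔ.eq
  have expand : (((1 : Matrix (Fin n) (Fin n) ℝ) + Δ) * X)ᵀ * Δ *
      (((1 : Matrix (Fin n) (Fin n) ℝ) + Δ) * X) =
      Xᵀ * Δ * X + (2 • ((Δ * X)ᵀ * (Δ * X)) + (Δ * X)ᵀ * Δ * (Δ * X)) := by
    simp only [Matrix.transpose_mul, Matrix.transpose_add, hT,
      Matrix.add_mul, Matrix.mul_add, Matrix.one_mul, Matrix.mul_assoc]
    abel
  have quadratic : 0 ≤ ((Δ * X)ᵀ * (Δ * X)).trace := by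
    simpa only [Matrix.conjTranspose_eq_transpose_of_trivial] using
      (Matrix.posSemidef_conjTranspose_mul_self (Δ * X)).trace_nonneg
  have cubic : 0 ≤ ((Δ * X)ᵀ * Δ * (Δ * X)).trace := by
    simpa only [Matrix.conjTranspose_eq_transpose_of_trivial] using
      (hpsd.conjTranspose_mul_mul_same (Δ * X)).trace_nonneg
  rw [expand, Matrix.trace_add, Matrix.trace_add, Matrix.trace_smul, nsmul_eq_mul]
  push_cast
  linarith
end

section
/- Let Δ, Q ∈ ℝ^{n×n} be symmetric matrices with Δ positive semidefinite, suppose Q commutes with Δ (Q Δ = Δ Q), and suppose every eigenvalue of Q is at least δ, where δ ≥ 0. Then for every X ∈ ℝ^{n×d}, tr( (Q X)ᵀ Δ (Q X) ) ≥ δ² · tr( Xᵀ Δ X ); i.e., applying the filter Q reduces the graph Dirichlet energy by at most the factor δ². -/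
open Matrix BigOperators

/-- A real symmetric matrix whose eigenvalues are all at least `δ` dominates `δ • 1`. -/
theorem Matrix.IsHermitian.posSemidef_sub_smul_one {n : Type*} [Fintype n] [DecidableEq n]
    {Q : Matrix n n ℝ} (hQ : Q.IsHermitian) {δ : ℝ}
    (heig : ∀ μ : ℝ, (∃ v : n → ℝ, v ≠ 0 ∧ Q *ᵥ v = μ • v) → δ ≤ μ) :
    (Q - δ • (1 : Matrix n n ℝ)).PosSemidef := by
  have hP : (Q - δ • (1 : Matrix n n ℝ)).IsHermitian :=
    hQ.sub (by simp [Matrix.IsHermitian])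
  rw [hP.posSemidef_iff_eigenvalues_nonneg]
  intro i
  have hv := hP.mulVec_eigenvectorBasis i
  rw [sub_mulVec, smul_mulVec, one_mulVec, sub_eq_iff_eq_add, ← add_smul] at hv
  have hne : (hP.eigenvectorBasis i : n → ℝ) ≠ 0 := by
    intro h
    refine hP.eigenvectorBasis.orthonormal.ne_zero i ?_
    ext j
    exact congrFun h j
  have := heig _ ⟨_, hne, hv⟩
  simpa using this

/-- If `Δ` is symmetric PSD, `Q` is symmetric, `Q` commutes with `Δ`, and every
eigenvalue of `Q` is at least `δ ≥ 0`, then applying the filter `Q` reduces the graph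
Dirichlet energy `tr(Xᵀ Δ X)` by at most the factor `δ²`. -/
theorem filter_energy_lower_bound {n d : ℕ} (Δ Q : Matrix (Fin n) (Fin n) ℝ)
    (hΔ : Δ.IsHermitian) (hQ : Q.IsHermitian) (hpsd : Δ.PosSemidef)
    (hcomm : Q * Δ = Δ * Q)
    (δ : ℝ) (hδ : 0 ≤ δ)
    (heig : ∀ μ : ℝ, (∃ v : Fin n → ℝ, v ≠ 0 ∧ Q *ᵥ v = μ • v) → δ ≤ μ)
    (X : Matrix (Fin n) (Fin d) ℝ) :
    δ ^ 2 * Matrix.trace (Xᵀ * Δ * X) ≤ Matrix.trace ((Q * X)ᵀ * Δ * (Q * X)) := by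
  have hP := hQ.posSemidef_sub_smul_one heig
  set P := Q - δ • (1 : Matrix (Fin n) (Fin n) ℝ) with hPdef
  have hQP : Q = P + δ • 1 := by simp [hPdef]
  have hPΔ : Commute P Δ := by
    rw [hPdef]
    exact Commute.sub_left hcomm ((Commute.one_left Δ).smul_left δ)
  have hPΔpsd : (P * Δ).PosSemidef := by
    open scoped MatrixOrder Matrix.Norms.L2Operator in
    exact (hPΔ.mul_nonneg hP.nonneg hpsd.nonneg).posSemidef
  have hPΔP : (P * Δ * P).PosSemidef := by
    simpa only [hP.isHermitian.eq] using hpsd.mul_mul_conjTranspose_same P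
  have hdiff : Q * Δ * Q - δ ^ 2 • Δ = P * Δ * P + (2 * δ) • (P * Δ) := by
    rw [hQP]
    simp only [add_mul, mul_add, smul_mul_assoc, mul_smul_comm, one_mul, mul_one, ← hPΔ.eq]
    module
  have hD := ((hPΔP.add (hPΔpsd.smul (by positivity : 0 ≤ 2 * δ))).conjTranspose_mul_mul_same
    X).trace_nonneg
  rw [← hdiff, conjTranspose_eq_transpose_of_trivial, Matrix.mul_sub, Matrix.sub_mul,
    Matrix.mul_smul, Matrix.smul_mul, trace_sub, trace_smul, sub_nonneg, smul_eq_mul] at hD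
  have hQt : Qᵀ = Q := by simpa using hQ.eq
  simpa only [transpose_mul, hQt, Matrix.mul_assoc] using hD
end
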